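/- Lack of uniform stability: for every ε ∈ (0,1) and every time T̄ > 0 there exists k₀ ∈ ℕ such that for every integer k ≥ k₀, every classical solution u of the degenerately damped wave equation on [0,T̄] with initial data u(0,x) = (2/(kπ)) sin(kπx) and ∂ₜu(0,x) = 0 (for which E_u(0) = 1) satisfies E_u(t) ≥ 1 − ε for all t ∈ [0,T̄]. Hence the energy of solutions does not decay at a rate uniform over bounded sets of initial data. -/

import Mathlib

open MeasureTheory Real Set

/-- The partial derivative in time of a function `u(t,x)`. -/
noncomputable def pdt (u : ℝ → ℝ → ℝ) : ℝ → ℝ → ℝ := fun t x => deriv (fun s => u s x) t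

/-- The partial derivative in space of a function `u(t,x)`. -/
noncomputable def pdx (u : ℝ → ℝ → ℝ) : ℝ → ℝ → ℝ := fun t x => deriv (fun y => u t y) x

/-- A classical (C²) solution of the degenerately damped wave equation
`∂ₜ²u - ∂ₓ²u + α u^(2m) ∂ₜu = 0` on `[0,T] × [0,1]` with homogeneous Dirichlet
boundary conditions. -/
def IsClassicalSolution (α : ℝ) (m : ℕ) (T : ℝ) (u : ℝ → ℝ → ℝ) : Prop :=
  ContDiff ℝ 2 (Function.uncurry u) ∧
  (∀ t ∈ Icc (0:ℝ) T, ∀ x ∈ Icc (0:ℝ) 1,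
    pdt (pdt u) t x - pdx (pdx u) t x + α * (u t x) ^ (2*m) * pdt u t x = 0) ∧
  (∀ t ∈ Icc (0:ℝ) T, u t 0 = 0 ∧ u t 1 = 0)

/-- The energy `E_u(t) = ½∫₀¹ (∂ₓu)² + ½∫₀¹ (∂ₜu)²`. -/
noncomputable def energy (u : ℝ → ℝ → ℝ) (t : ℝ) : ℝ :=
  (1/2) * (∫ x in (0:ℝ)..1, (pdx u t x)^2) + (1/2) * (∫ x in (0:ℝ)..1, (pdt u t x)^2)

section Partial

variable {f : ℝ → ℝ → ℝ} {n : WithTop ℕ∞}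

lemma pdt_eq_fderiv (hf : ContDiff ℝ 1 (Function.uncurry f)) (t x : ℝ) :
    HasDerivAt (fun s => f s x) (fderiv ℝ (Function.uncurry f) (t, x) (1, 0)) t := by
  have h := (hf.differentiable (by norm_num) (t, x)).hasFDerivAt
  exact h.comp_hasDerivAt t ((hasDerivAt_id t).prodMk (hasDerivAt_const t x))

lemma pdx_eq_fderiv (hf : ContDiff ℝ 1 (Function.uncurry f)) (t x : ℝ) :
    HasDerivAt (fun y => f t y) (fderiv ℝ (Function.uncurry f) (t, x) (0, 1)) x := by
  have h := (hf.differentiable (by norm_num) (t, x)).hasFDerivAt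
  exact h.comp_hasDerivAt x ((hasDerivAt_const x t).prodMk (hasDerivAt_id x))

lemma uncurry_pdt (hf : ContDiff ℝ 1 (Function.uncurry f)) :
    Function.uncurry (pdt f) = fun p => fderiv ℝ (Function.uncurry f) p (1, 0) := by
  ext ⟨t, x⟩
  exact (pdt_eq_fderiv hf t x).deriv

lemma uncurry_pdx (hf : ContDiff ℝ 1 (Function.uncurry f)) :
    Function.uncurry (pdx f) = fun p => fderiv ℝ (Function.uncurry f) p (0, 1) := by
  ext ⟨t, x⟩
  exact (pdx_eq_fderiv hf t x).deriv

lemma hasDerivAt_pdt (hf : ContDiff ℝ 1 (Function.uncurry f)) (t x : ℝ) :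
    HasDerivAt (fun s => f s x) (pdt f t x) t :=
  (pdt_eq_fderiv hf t x).differentiableAt.hasDerivAt

lemma hasDerivAt_pdx (hf : ContDiff ℝ 1 (Function.uncurry f)) (t x : ℝ) :
    HasDerivAt (fun y => f t y) (pdx f t x) x :=
  (pdx_eq_fderiv hf t x).differentiableAt.hasDerivAt

lemma contDiff_pdt (hf : ContDiff ℝ (n + 1) (Function.uncurry f)) :
    ContDiff ℝ n (Function.uncurry (pdt f)) := by
  rw [uncurry_pdt (hf.of_le le_add_self)]
  exact (hf.fderiv_right le_rfl).clm_apply contDiff_const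

lemma contDiff_pdx (hf : ContDiff ℝ (n + 1) (Function.uncurry f)) :
    ContDiff ℝ n (Function.uncurry (pdx f)) := by
  rw [uncurry_pdx (hf.of_le le_add_self)]
  exact (hf.fderiv_right le_rfl).clm_apply contDiff_const

lemma pdt_pdx_comm (hf : ContDiff ℝ 2 (Function.uncurry f)) (t x : ℝ) :
    pdt (pdx f) t x = pdx (pdt f) t x := by
  have h1 : ContDiff ℝ 1 (Function.uncurry f) := hf.of_le (by norm_num)
  have h2 : ContDiff ℝ (1 + 1) (Function.uncurry f) := hf.of_le (by norm_num)
  have hd : DifferentiableAt ℝ (fderiv ℝ (Function.uncurry f)) (t, x) :=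
    (h2.fderiv_right le_rfl).differentiable (by norm_num) _
  have key : ∀ v w, fderiv ℝ (fun p => fderiv ℝ (Function.uncurry f) p v) (t, x) w
      = fderiv ℝ (fderiv ℝ (Function.uncurry f)) (t, x) w v := by
    intro v w
    rw [(hd.hasFDerivAt.clm_apply (hasFDerivAt_const v _)).fderiv]
    simp
  have e1 : pdt (pdx f) t x = _ := (pdt_eq_fderiv (contDiff_pdx h2) t x).deriv
  have e2 : pdx (pdt f) t x = _ := (pdx_eq_fderiv (contDiff_pdt h2) t x).deriv
  rw [e1, e2, uncurry_pdx h1, uncurry_pdt h1, key, key]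
  exact (hf.contDiffAt.isSymmSndFDerivAt (by simp)) _ _

end Partial

lemma hasDerivAt_intervalIntegral_of_continuous {F F' : ℝ → ℝ → ℝ}
    (hF : Continuous (Function.uncurry F)) (hF' : Continuous (Function.uncurry F'))
    (h : ∀ t x, HasDerivAt (fun s => F s x) (F' t x) t) (a b t : ℝ) :
    HasDerivAt (fun s => ∫ x in a..b, F s x) (∫ x in a..b, F' t x) t := by
  obtain ⟨C, hC⟩ := ((isCompact_closedBall t 1).prod (isCompact_uIcc
    (a := a) (b := b))).exists_bound_of_continuousOn hF'.continuousOn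
  refine (intervalIntegral.hasDerivAt_integral_of_dominated_loc_of_deriv_le
    (bound := fun _ => C) (Metric.closedBall_mem_nhds t one_pos) ?_ ?_ ?_ ?_ ?_ ?_).2
  · exact .of_forall fun s => (hF.uncurry_left s).aestronglyMeasurable
  · exact (hF.uncurry_left t).intervalIntegrable _ _
  · exact (hF'.uncurry_left t).aestronglyMeasurable
  · exact .of_forall fun x hx s hs => hC (s, x) ⟨hs, uIoc_subset_uIcc hx⟩
  · exact intervalIntegrable_const
  · exact .of_forall fun x _ s _ => h s x

lemma sub_le_mul_of_hasDerivAt_le {f f' : ℝ → ℝ} {C T : ℝ} (hf : ∀ t, HasDerivAt f (f' t) t)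
    (h : ∀ t ∈ Ioo 0 T, f' t ≤ C) {t : ℝ} (ht : t ∈ Icc 0 T) : f t - f 0 ≤ C * t := by
  have := (convex_Icc (0 : ℝ) T).image_sub_le_mul_sub_of_deriv_le (f := f) (C := C)
    (fun s _ => (hf s).continuousAt.continuousWithinAt)
    (fun s _ => (hf s).differentiableAt.differentiableWithinAt)
    (fun s hs => by rw [(hf s).deriv]; exact h s (by rwa [interior_Icc] at hs))
    0 ⟨le_rfl, ht.1.trans ht.2⟩ t ht ht.1
  simpa using this

/-- A weighted one-dimensional Sobolev inequality. -/
lemma sq_le_integral_sq_add {f f' : ℝ → ℝ} (hf : ∀ x, HasDerivAt f (f' x) x)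
    (hf' : Continuous f') (h0 : f 0 = 0) {c : ℝ} (hc : 0 < c) {x : ℝ} (hx : x ∈ Icc (0 : ℝ) 1) :
    f x ^ 2 ≤ c * (∫ y in (0 : ℝ)..1, f y ^ 2) + c⁻¹ * ∫ y in (0 : ℝ)..1, f' y ^ 2 := by
  have hfc : Continuous f := continuous_iff_continuousAt.2 fun y => (hf y).continuousAt
  have h1 : ∫ y in (0 : ℝ)..x, 2 * f y * f' y = f x ^ 2 := by
    rw [intervalIntegral.integral_eq_sub_of_hasDerivAt (f := fun y => f y ^ 2)
      (fun y _ => by simpa using (hf y).fun_pow 2)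
      (Continuous.intervalIntegrable (by fun_prop) _ _)]
    simp [h0]
  have h2 : ∫ y in (0 : ℝ)..x, 2 * f y * f' y
      ≤ ∫ y in (0 : ℝ)..x, (c * f y ^ 2 + c⁻¹ * f' y ^ 2) := by
    refine intervalIntegral.integral_mono_on hx.1
      (Continuous.intervalIntegrable (by fun_prop) _ _)
      (Continuous.intervalIntegrable (by fun_prop) _ _) fun y _ => ?_
    have : c * f y ^ 2 + c⁻¹ * f' y ^ 2 - 2 * f y * f' y = c⁻¹ * (c * f y - f' y) ^ 2 := by
      field_simp
      ring
    have : 0 ≤ c⁻¹ * (c * f y - f' y) ^ 2 := by positivity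
    linarith
  have h3 : ∫ y in (0 : ℝ)..x, (c * f y ^ 2 + c⁻¹ * f' y ^ 2)
      ≤ ∫ y in (0 : ℝ)..1, (c * f y ^ 2 + c⁻¹ * f' y ^ 2) :=
    intervalIntegral.integral_mono_interval le_rfl hx.1 hx.2
      (.of_forall fun y => by simp only [Pi.zero_apply]; positivity)
      (Continuous.intervalIntegrable (by fun_prop) _ _)
  rw [← intervalIntegral.integral_const_mul, ← intervalIntegral.integral_const_mul,
    ← intervalIntegral.integral_add (Continuous.intervalIntegrable (by fun_prop) _ _)
      (Continuous.intervalIntegrable (by fun_prop) _ _)]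
  linarith

lemma pow_mul_sub_pow_le {a b A : ℝ} (m : ℕ) (ha : |a| ≤ A) :
    a ^ (2 * m + 1) * b - b ^ (2 * m + 2) ≤ A ^ (2 * m + 2) := by
  have hab : a ^ (2 * m + 1) * b ≤ |a| ^ (2 * m + 1) * |b| := by
    rw [← abs_pow, ← abs_mul]
    exact le_abs_self _
  have hb : b ^ (2 * m + 2) = |b| ^ (2 * m + 1) * |b| := by
    rw [← pow_succ, Even.pow_abs ⟨m + 1, by ring⟩]
  have hA : |a| ^ (2 * m + 2) ≤ A ^ (2 * m + 2) := by gcongr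
  have ha' : |a| ^ (2 * m + 2) = |a| ^ (2 * m + 1) * |a| := pow_succ _ _
  rcases le_total |a| |b| with h | h
  · have : |a| ^ (2 * m + 1) * |b| ≤ |b| ^ (2 * m + 1) * |b| := by gcongr
    have : 0 ≤ |a| ^ (2 * m + 2) := by positivity
    linarith
  · have : |a| ^ (2 * m + 1) * |b| ≤ |a| ^ (2 * m + 1) * |a| := by gcongr
    have : 0 ≤ |b| ^ (2 * m + 1) * |b| := by positivity
    linarith

section Solution

variable {α T : ℝ} {m : ℕ} {u : ℝ → ℝ → ℝ}

/-- The energy identity, in differential form. -/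
lemma hasDerivAt_energy (hu : ContDiff ℝ 2 (Function.uncurry u)) (t : ℝ) :
    HasDerivAt (energy u)
      (∫ x in (0 : ℝ)..1, (pdx u t x * pdt (pdx u) t x + pdt u t x * pdt (pdt u) t x)) t := by
  have h2 : ContDiff ℝ (1 + 1) (Function.uncurry u) := hu.of_le (by norm_num)
  have hx := contDiff_pdx h2
  have ht := contDiff_pdt h2
  have hxt : Continuous (Function.uncurry (pdt (pdx u))) :=
    (contDiff_pdt (n := 0) (by simpa using hx)).continuous
  have htt : Continuous (Function.uncurry (pdt (pdt u))) :=
    (contDiff_pdt (n := 0) (by simpa using ht)).continuous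
  have hxc := hx.continuous
  have htc := ht.continuous
  have key := hasDerivAt_intervalIntegral_of_continuous
    (F := fun t x => (1 / 2) * pdx u t x ^ 2 + (1 / 2) * pdt u t x ^ 2)
    (F' := fun t x => pdx u t x * pdt (pdx u) t x + pdt u t x * pdt (pdt u) t x)
    (by fun_prop) (by fun_prop)
    (fun t x => by
      refine ((((hasDerivAt_pdt hx t x).fun_pow 2).const_mul (1 / 2)).fun_add
        (((hasDerivAt_pdt ht t x).fun_pow 2).const_mul (1 / 2))).congr_deriv ?_
      push_cast
      ring) 0 1 t
  convert key using 1
  ext s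
  have h1 := hxc.uncurry_left s
  have h2 := htc.uncurry_left s
  rw [intervalIntegral.integral_add (Continuous.intervalIntegrable (by fun_prop) _ _)
    (Continuous.intervalIntegrable (by fun_prop) _ _), intervalIntegral.integral_const_mul,
    intervalIntegral.integral_const_mul, energy]

lemma pdt_eq_zero_of_eqOn_Icc {x t : ℝ} (h : ∀ s ∈ Icc 0 T, u s x = 0) (ht : t ∈ Ioo 0 T) :
    pdt u t x = 0 := by
  have : (fun s => u s x) =ᶠ[nhds t] fun _ => 0 := by
    filter_upwards [Ioo_mem_nhds ht.1 ht.2] with s hs using h s (Ioo_subset_Icc_self hs)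
  rw [pdt, this.deriv_eq, deriv_const]

lemma integral_energy_deriv (hu : IsClassicalSolution α m T u) {t : ℝ} (ht : t ∈ Ioo 0 T) :
    ∫ x in (0 : ℝ)..1, (pdx u t x * pdt (pdx u) t x + pdt u t x * pdt (pdt u) t x)
      = -∫ x in (0 : ℝ)..1, α * u t x ^ (2 * m) * pdt u t x ^ 2 := by
  obtain ⟨hc, heq, hbd⟩ := hu
  have h2 : ContDiff ℝ (1 + 1) (Function.uncurry u) := hc.of_le (by norm_num)
  have hx := contDiff_pdx h2
  have ht' := contDiff_pdt h2
  have hxx := (contDiff_pdx (n := 0) (f := pdx u) (by simpa using hx)).continuous.uncurry_left t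
  have htx := (contDiff_pdx (n := 0) (f := pdt u) (by simpa using ht')).continuous.uncurry_left t
  have htt := (contDiff_pdt (n := 0) (f := pdt u) (by simpa using ht')).continuous.uncurry_left t
  have hxc := hx.continuous.uncurry_left t
  have htc := ht'.continuous.uncurry_left t
  have huc := hc.continuous.uncurry_left t
  have hflux :
      ∫ x in (0 : ℝ)..1, (pdx (pdx u) t x * pdt u t x + pdx u t x * pdx (pdt u) t x) = 0 := by
    rw [intervalIntegral.integral_eq_sub_of_hasDerivAt (f := fun x => pdx u t x * pdt u t x)
      (fun x _ => (hasDerivAt_pdx hx t x).mul (hasDerivAt_pdx ht' t x))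
      (Continuous.intervalIntegrable (by fun_prop) _ _),
      pdt_eq_zero_of_eqOn_Icc (fun s hs => (hbd s hs).1) ht,
      pdt_eq_zero_of_eqOn_Icc (fun s hs => (hbd s hs).2) ht]
    simp
  simp only [pdt_pdx_comm hc]
  rw [← sub_eq_zero, sub_neg_eq_add]
  refine Eq.trans ?_ hflux
  rw [← intervalIntegral.integral_add
    (Continuous.intervalIntegrable (by fun_prop) _ _)
    (Continuous.intervalIntegrable (by fun_prop) _ _)]
  refine intervalIntegral.integral_congr fun x hx => ?_
  rw [uIcc_of_le zero_le_one] at hx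
  have := heq t (Ioo_subset_Icc_self ht) x hx
  linear_combination (pdt u t x) * this

lemma integral_damping_le (hα : 0 ≤ α) (hu : IsClassicalSolution α m T u) {δ t : ℝ} (hδ : 0 ≤ δ)
    (hsmall : ∀ x ∈ Icc (0 : ℝ) 1, u t x ^ (2 * m) ≤ δ) :
    ∫ x in (0 : ℝ)..1, α * u t x ^ (2 * m) * pdt u t x ^ 2 ≤ 2 * α * δ * energy u t := by
  have h2 : ContDiff ℝ (1 + 1) (Function.uncurry u) := hu.1.of_le (by norm_num)
  have htc := (contDiff_pdt h2).continuous.uncurry_left t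
  have huc := hu.1.continuous.uncurry_left t
  have h : ∫ x in (0 : ℝ)..1, α * u t x ^ (2 * m) * pdt u t x ^ 2
      ≤ ∫ x in (0 : ℝ)..1, α * δ * pdt u t x ^ 2 := by
    refine intervalIntegral.integral_mono_on zero_le_one
      (Continuous.intervalIntegrable (by fun_prop) _ _)
      (Continuous.intervalIntegrable (by fun_prop) _ _) fun x hx => ?_
    have := hsmall x hx
    gcongr
  rw [intervalIntegral.integral_const_mul] at h
  have h0 : 0 ≤ ∫ x in (0 : ℝ)..1, pdx u t x ^ 2 :=
    intervalIntegral.integral_nonneg zero_le_one fun x _ => sq_nonneg _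
  have h3 : 0 ≤ α * δ * ∫ x in (0 : ℝ)..1, pdx u t x ^ 2 := by positivity
  rw [energy]
  linarith

lemma energy_le (hα : 0 ≤ α) (hu : IsClassicalSolution α m T u) {t : ℝ} (ht : t ∈ Icc 0 T) :
    energy u t ≤ energy u 0 := by
  have := sub_le_mul_of_hasDerivAt_le (C := 0) (hasDerivAt_energy hu.1) (fun s hs => by
    rw [integral_energy_deriv hu hs, neg_nonpos]
    exact intervalIntegral.integral_nonneg zero_le_one fun x _ =>
      mul_nonneg (mul_nonneg hα (Even.pow_nonneg ⟨m, two_mul m⟩ _)) (sq_nonneg _)) ht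
  linarith

/-- If the solution is uniformly small, then its energy decays slowly. -/
lemma le_energy (hα : 0 ≤ α) (hu : IsClassicalSolution α m T u) {δ t : ℝ} (hδ : 0 ≤ δ)
    (ht : t ∈ Icc 0 T) (hsmall : ∀ s ∈ Icc 0 T, ∀ x ∈ Icc (0 : ℝ) 1, u s x ^ (2 * m) ≤ δ) :
    energy u 0 - 2 * α * δ * energy u 0 * t ≤ energy u t := by
  have := sub_le_mul_of_hasDerivAt_le (C := 2 * α * δ * energy u 0)
    (fun t => (hasDerivAt_energy hu.1 t).fun_neg) (fun s hs => by
    rw [integral_energy_deriv hu hs, neg_neg]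
    refine (integral_damping_le hα hu hδ (hsmall s (Ioo_subset_Icc_self hs))).trans ?_
    have := energy_le hα hu (Ioo_subset_Icc_self hs)
    gcongr) ht
  linarith

/-- Integrating the equation in time. -/
lemma integral_pdx_pdx (hu : IsClassicalSolution α m T u) {t x : ℝ} (ht : t ∈ Icc 0 T)
    (hx : x ∈ Icc (0 : ℝ) 1) :
    ∫ s in (0 : ℝ)..t, pdx (pdx u) s x = pdt u t x - pdt u 0 x
      + α / (2 * m + 1) * (u t x ^ (2 * m + 1) - u 0 x ^ (2 * m + 1)) := by
  obtain ⟨hc, heq, -⟩ := hu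
  have h2 : ContDiff ℝ (1 + 1) (Function.uncurry u) := hc.of_le (by norm_num)
  have h1 : ContDiff ℝ 1 (Function.uncurry u) := hc.of_le (by norm_num)
  have ht' := contDiff_pdt h2
  have htt := (contDiff_pdt (n := 0) (f := pdt u) (by simpa using ht')).continuous.uncurry_right x
  have htc := ht'.continuous.uncurry_right x
  have huc := hc.continuous.uncurry_right x
  have hm : (2 * m + 1 : ℝ) ≠ 0 := by positivity
  have key : ∫ s in (0 : ℝ)..t, (pdt (pdt u) s x + α * u s x ^ (2 * m) * pdt u s x)
      = (pdt u t x + α / (2 * m + 1) * u t x ^ (2 * m + 1))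
        - (pdt u 0 x + α / (2 * m + 1) * u 0 x ^ (2 * m + 1)) := by
    refine intervalIntegral.integral_eq_sub_of_hasDerivAt
      (f := fun s => pdt u s x + α / (2 * m + 1) * u s x ^ (2 * m + 1)) (fun s _ => ?_)
      (Continuous.intervalIntegrable (by fun_prop) _ _)
    refine ((hasDerivAt_pdt ht' s x).fun_add
      (((hasDerivAt_pdt h1 s x).fun_pow (2 * m + 1)).const_mul (α / (2 * m + 1)))).congr_deriv ?_
    rw [Nat.add_sub_cancel]
    push_cast
    field_simp
  have hcongr : ∫ s in (0 : ℝ)..t, pdx (pdx u) s x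
      = ∫ s in (0 : ℝ)..t, (pdt (pdt u) s x + α * u s x ^ (2 * m) * pdt u s x) := by
    refine intervalIntegral.integral_congr fun s hs => ?_
    rw [uIcc_of_le ht.1] at hs
    have := heq s ⟨hs.1, hs.2.trans ht.2⟩ x hx
    linarith
  rw [hcongr, key]
  ring

/-- The `L²` norm of a solution with zero initial velocity is controlled by the size of the
initial displacement. -/
lemma integral_sq_le (hα : 0 ≤ α) (hu : IsClassicalSolution α m T u)
    (hv : ∀ x ∈ Icc (0 : ℝ) 1, pdt u 0 x = 0) {A : ℝ} (hA : ∀ x ∈ Icc (0 : ℝ) 1, |u 0 x| ≤ A)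
    {t : ℝ} (ht : t ∈ Icc 0 T) :
    ∫ x in (0 : ℝ)..1, u t x ^ 2 ≤ A ^ 2 + 2 * (α / (2 * m + 1)) * A ^ (2 * m + 2) * t := by
  have hc := hu.1
  have h2 : ContDiff ℝ (1 + 1) (Function.uncurry u) := hc.of_le (by norm_num)
  have h1 : ContDiff ℝ 1 (Function.uncurry u) := hc.of_le (by norm_num)
  have hx := contDiff_pdx h2
  have ht' := contDiff_pdt h2
  have hxx := (contDiff_pdx (n := 0) (f := pdx u) (by simpa using hx)).continuous
  have hxc := hx.continuous
  have htc := ht'.continuous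
  have huc := hc.continuous
  set W : ℝ → ℝ → ℝ := fun t x => ∫ s in (0 : ℝ)..t, pdx u s x with hW
  have hWc : Continuous (Function.uncurry W) :=
    intervalIntegral.continuous_parametric_intervalIntegral_of_continuous
      (f := fun (p : ℝ × ℝ) s => pdx u s p.2) (s := fun p => p.1) (by fun_prop) (by fun_prop)
  have hWt : ∀ t x, HasDerivAt (fun s => W s x) (pdx u t x) t := fun t x =>
    intervalIntegral.integral_hasDerivAt_right
      ((hxc.uncurry_right x).intervalIntegrable _ _)
      ((hxc.uncurry_right x).stronglyMeasurableAtFilter _ _) (hxc.uncurry_right x).continuousAt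
  have hWx : ∀ t x, HasDerivAt (fun y => W t y) (∫ s in (0 : ℝ)..t, pdx (pdx u) s x) x :=
    fun t x => hasDerivAt_intervalIntegral_of_continuous (F := fun y s => pdx u s y)
      (F' := fun y s => pdx (pdx u) s y) (by fun_prop) (by fun_prop)
      (fun y s => hasDerivAt_pdx hx s y) 0 t x
  have hWxc : ∀ t, Continuous fun x => ∫ s in (0 : ℝ)..t, pdx (pdx u) s x := fun t =>
    intervalIntegral.continuous_parametric_intervalIntegral_of_continuous'
      (f := fun x s => pdx (pdx u) s x) (by fun_prop) _ _
  have hderiv := hasDerivAt_intervalIntegral_of_continuous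
    (F := fun t x => u t x ^ 2 + W t x ^ 2)
    (F' := fun t x => 2 * u t x * pdt u t x + 2 * W t x * pdx u t x)
    (by fun_prop) (by fun_prop)
    (fun t x => by
      refine (((hasDerivAt_pdt h1 t x).fun_pow 2).fun_add
        ((hWt t x).fun_pow 2)).congr_deriv ?_
      push_cast
      ring) 0 1
  have hbound : ∀ s ∈ Ioo 0 T, ∫ x in (0 : ℝ)..1, (2 * u s x * pdt u s x + 2 * W s x * pdx u s x)
      ≤ 2 * (α / (2 * m + 1)) * A ^ (2 * m + 2) := by
    intro s hs
    have hs' := Ioo_subset_Icc_self hs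
    have e1 := hxc.uncurry_left s
    have e2 := htc.uncurry_left s
    have e3 := huc.uncurry_left s
    have e4 := hWc.uncurry_left s
    have e5 := hWxc s
    have hflux : ∫ x in (0 : ℝ)..1,
        ((∫ r in (0 : ℝ)..s, pdx (pdx u) r x) * u s x + W s x * pdx u s x) = 0 := by
      rw [intervalIntegral.integral_eq_sub_of_hasDerivAt (f := fun x => W s x * u s x)
        (fun x _ => (hWx s x).mul (hasDerivAt_pdx h1 s x))
        (Continuous.intervalIntegrable (by fun_prop) _ _), (hu.2.2 s hs').1, (hu.2.2 s hs').2]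
      simp
    have hle : (∫ x in (0 : ℝ)..1, (2 * u s x * pdt u s x + 2 * W s x * pdx u s x))
        - ∫ x in (0 : ℝ)..1,
          2 * ((∫ r in (0 : ℝ)..s, pdx (pdx u) r x) * u s x + W s x * pdx u s x)
        ≤ ∫ x in (0 : ℝ)..1, 2 * (α / (2 * m + 1)) * A ^ (2 * m + 2) := by
      rw [← intervalIntegral.integral_sub (Continuous.intervalIntegrable (by fun_prop) _ _)
        (Continuous.intervalIntegrable (by fun_prop) _ _)]
      refine intervalIntegral.integral_mono_on zero_le_one
        (Continuous.intervalIntegrable (by fun_prop) _ _) intervalIntegrable_const fun x hx => ?_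
      rw [integral_pdx_pdx hu hs' hx, hv x hx]
      have hp := mul_le_mul_of_nonneg_left (pow_mul_sub_pow_le (b := u s x) m (hA x hx))
        (by positivity : 0 ≤ 2 * (α / (2 * m + 1)))
      refine le_trans (le_of_eq ?_) hp
      ring
    rw [intervalIntegral.integral_const_mul, hflux] at hle
    simpa using hle
  have h := sub_le_mul_of_hasDerivAt_le hderiv hbound ht
  have e3 := huc.uncurry_left t
  have e4 := hWc.uncurry_left t
  have hlow : ∫ x in (0 : ℝ)..1, u t x ^ 2 ≤ ∫ x in (0 : ℝ)..1, (u t x ^ 2 + W t x ^ 2) :=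
    intervalIntegral.integral_mono_on zero_le_one
      (Continuous.intervalIntegrable (by fun_prop) _ _)
      (Continuous.intervalIntegrable (by fun_prop) _ _) fun x _ => by
        linarith [sq_nonneg (W t x)]
  have hinit : ∫ x in (0 : ℝ)..1, (u 0 x ^ 2 + W 0 x ^ 2) ≤ ∫ x in (0 : ℝ)..1, A ^ 2 := by
    have e5 := huc.uncurry_left 0
    have e6 := hWc.uncurry_left 0
    refine intervalIntegral.integral_mono_on zero_le_one
      (Continuous.intervalIntegrable (by fun_prop) _ _) intervalIntegrable_const fun x hx => ?_
    have : W 0 x = 0 := by simp [hW]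
    rw [this, ← sq_abs (u 0 x)]
    have := hA x hx
    have : |u 0 x| ^ 2 ≤ A ^ 2 := by gcongr
    linarith
  simp only [intervalIntegral.integral_const, sub_zero, one_smul] at hinit
  linarith

lemma integral_sq_two_mul_cos {c : ℝ} (hc : c ≠ 0) (hs : sin c = 0) :
    ∫ x in (0 : ℝ)..1, (2 * cos (c * x)) ^ 2 = 2 := by
  rw [intervalIntegral.integral_eq_sub_of_hasDerivAt
    (f := fun x => 2 * x + 2 / c * (sin (c * x) * cos (c * x))) (fun x _ => ?_)
    (Continuous.intervalIntegrable (by fun_prop) _ _)]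
  · simp [hs]
  · have hl : HasDerivAt (fun x => c * x) c x := by simpa using (hasDerivAt_id x).const_mul c
    refine (((hasDerivAt_id' x).const_mul 2).fun_add
      ((hl.sin.fun_mul hl.cos).const_mul (2 / c))).congr_deriv ?_
    field_simp
    linear_combination -sin_sq_add_cos_sq (c * x)

lemma energy_zero_eq_one {k : ℕ} (hk : k ≠ 0)
    (h0 : ∀ x ∈ Icc (0 : ℝ) 1, u 0 x = (2 / ((k : ℝ) * π)) * sin ((k : ℝ) * π * x))
    (hv : ∀ x ∈ Icc (0 : ℝ) 1, pdt u 0 x = 0) : energy u 0 = 1 := by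
  have hc : (k : ℝ) * π ≠ 0 := by positivity
  have hX : ∫ x in (0 : ℝ)..1, pdx u 0 x ^ 2 = ∫ x in (0 : ℝ)..1, (2 * cos (k * π * x)) ^ 2 := by
    refine intervalIntegral.integral_congr_uIoo fun x hx => ?_
    rw [uIoo_of_le zero_le_one] at hx
    have he : u 0 =ᶠ[nhds x] fun y => (2 / ((k : ℝ) * π)) * sin ((k : ℝ) * π * y) := by
      filter_upwards [Ioo_mem_nhds hx.1 hx.2] with y hy using h0 y (Ioo_subset_Icc_self hy)
    have hl : HasDerivAt (fun x => k * π * x) (k * π) x := by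
      simpa using (hasDerivAt_id x).const_mul (k * π)
    have hd : pdx u 0 x = _ := he.deriv_eq.trans (hl.sin.const_mul _).deriv
    rw [hd]
    field_simp
  have hT : ∫ x in (0 : ℝ)..1, pdt u 0 x ^ 2 = ∫ x in (0 : ℝ)..1, (0 : ℝ) := by
    refine intervalIntegral.integral_congr fun x hx => ?_
    rw [uIcc_of_le zero_le_one] at hx
    simp [hv x hx]
  rw [energy, hX, hT, integral_sq_two_mul_cos hc (sin_nat_mul_pi k)]
  simp

/-- Solutions starting from the high-frequency data are uniformly small. -/
lemma sq_le_div_of_oscillating_data (hα : 0 ≤ α) (hu : IsClassicalSolution α m T u) {k : ℕ}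
    (hk : k ≠ 0)
    (h0 : ∀ x ∈ Icc (0 : ℝ) 1, u 0 x = (2 / ((k : ℝ) * π)) * sin ((k : ℝ) * π * x))
    (hv : ∀ x ∈ Icc (0 : ℝ) 1, pdt u 0 x = 0) {t x : ℝ} (ht : t ∈ Icc 0 T)
    (hx : x ∈ Icc (0 : ℝ) 1) : u t x ^ 2 ≤ (3 + 2 * α * T) / k := by
  have hk1 : (1 : ℝ) ≤ k := by exact_mod_cast Nat.one_le_iff_ne_zero.2 hk
  have hk0 : (0 : ℝ) < k := by linarith
  have hA : ∀ x ∈ Icc (0 : ℝ) 1, |u 0 x| ≤ (k : ℝ)⁻¹ := fun y hy => by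
    rw [h0 y hy, abs_mul, abs_of_pos (by positivity)]
    calc 2 / (k * π) * |sin (k * π * y)| ≤ 2 / (k * π) * 1 := by
          gcongr
          exact abs_sin_le_one _
      _ ≤ (k : ℝ)⁻¹ := by
          rw [mul_one, inv_eq_one_div, div_le_div_iff₀ (by positivity) hk0]
          nlinarith [pi_gt_three]
  have hL2 := integral_sq_le hα hu hv hA ht
  have hpow : ((k : ℝ)⁻¹) ^ (2 * m + 2) ≤ ((k : ℝ)⁻¹) ^ 2 :=
    pow_le_pow_of_le_one (by positivity) (inv_le_one_of_one_le₀ hk1) (by omega)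
  have hβ : α / (2 * m + 1) ≤ α := div_le_self hα (by linarith [(Nat.cast_nonneg m : (0 : ℝ) ≤ m)])
  have ht0 := ht.1
  have hL2' : ∫ x in (0 : ℝ)..1, u t x ^ 2 ≤ (1 + 2 * α * T) * ((k : ℝ)⁻¹) ^ 2 := by
    calc _ ≤ _ := hL2
      _ ≤ ((k : ℝ)⁻¹) ^ 2 + 2 * α * ((k : ℝ)⁻¹) ^ 2 * T := by
          gcongr
          exact ht.2
      _ = _ := by ring
  have hE := energy_le hα hu ht
  rw [energy_zero_eq_one hk h0 hv, energy] at hE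
  have hT0 : 0 ≤ ∫ x in (0 : ℝ)..1, pdt u t x ^ 2 :=
    intervalIntegral.integral_nonneg zero_le_one fun x _ => sq_nonneg _
  have hX : ∫ x in (0 : ℝ)..1, pdx u t x ^ 2 ≤ 2 := by linarith
  have h2 : ContDiff ℝ (1 + 1) (Function.uncurry u) := hu.1.of_le (by norm_num)
  have hsob := sq_le_integral_sq_add (fun y => hasDerivAt_pdx (hu.1.of_le (by norm_num)) t y)
    ((contDiff_pdx h2).continuous.uncurry_left t) (hu.2.2 t ht).1 hk0 hx
  calc u t x ^ 2 ≤ _ := hsob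
    _ ≤ k * ((1 + 2 * α * T) * ((k : ℝ)⁻¹) ^ 2) + (k : ℝ)⁻¹ * 2 := by gcongr
    _ = (3 + 2 * α * T) / k := by
      field_simp
      ring

end Solution

/-- Lack of uniform stability: for high-frequency, unit-energy initial data the energy
stays above `1 - ε` on `[0, T̄]`. -/
theorem lack_of_uniform_stability
    (α : ℝ) (hα : 0 < α) (m : ℕ) (hm : 1 ≤ m)
    (ε : ℝ) (hε : ε ∈ Ioo (0:ℝ) 1) (Tbar : ℝ) (hTbar : 0 < Tbar) :
    ∃ k₀ : ℕ, ∀ k : ℕ, k₀ ≤ k → ∀ u : ℝ → ℝ → ℝ,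
      IsClassicalSolution α m Tbar u →
      (∀ x ∈ Icc (0:ℝ) 1, u 0 x = (2 / ((k:ℝ) * π)) * Real.sin ((k:ℝ) * π * x)) →
      (∀ x ∈ Icc (0:ℝ) 1, pdt u 0 x = 0) →
      ∀ t ∈ Icc (0:ℝ) Tbar, 1 - ε ≤ energy u t := by
  have hε0 := hε.1
  set K : ℝ := 3 + 2 * α * Tbar with hK
  have hK0 : 0 < K := by positivity
  obtain ⟨k₀, hk₀⟩ := exists_nat_ge (max K (2 * α * K * Tbar / ε))
  refine ⟨k₀, fun k hk u hu h0 hv t ht => ?_⟩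
  have hkk : max K (2 * α * K * Tbar / ε) ≤ k := hk₀.trans (by exact_mod_cast hk)
  have hkK : K ≤ k := (le_max_left _ _).trans hkk
  have hk0 : (0 : ℝ) < k := by linarith
  have hkε := (div_le_iff₀ hε0).1 ((le_max_right _ _).trans hkk)
  have hkne : k ≠ 0 := by exact_mod_cast hk0.ne'
  have hsmall : ∀ s ∈ Icc 0 Tbar, ∀ x ∈ Icc (0 : ℝ) 1, u s x ^ (2 * m) ≤ K / k := by
    intro s hs x hx
    have h := sq_le_div_of_oscillating_data hα.le hu hkne h0 hv hs hx
    have h1 : K / k ≤ 1 := (div_le_one hk0).2 hkK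
    rw [pow_mul]
    exact (pow_le_of_le_one (sq_nonneg _) (h.trans h1) (by omega)).trans h
  have h := le_energy hα.le hu (by positivity : 0 ≤ K / k) ht hsmall
  rw [energy_zero_eq_one hkne h0 hv] at h
  have hloss : 2 * α * (K / k) * 1 * t ≤ ε := by
    calc 2 * α * (K / k) * 1 * t ≤ 2 * α * (K / k) * 1 * Tbar := by
          gcongr
          exact ht.2
      _ = 2 * α * K * Tbar / k := by ring
      _ ≤ ε := (div_le_iff₀ hk0).2 (by linarith)
  linarith
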